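/- arXiv:1810.08035 — 2 statements merged into one kernel-verified Lean document; each statement's English description precedes it below -/
import Mathlib

section
/- Let σ > 0, b > 0, ρ > 0, 0 < q < 1, 0 ≤ δ < σ², and R > 0 be reals satisfying (σ² − δ) σ² e^(2R/b) < 1. Define p(J) = (1 − q)^(J/ρ) for real J. Then the equation σ² · p(J) + (1 − p(J)) · (σ² − e^(−2R/b)/σ²) = δ has the unique real solution J = ρ · ln(1 + (δ − σ²) σ² e^(2R/b)) / ln(1 − q), and this J is positive. -/
open Real

/-- The error bound, written with `E⁻¹` for the decaying exponential, is linear in `p`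
and is met at exactly one value of `p`. -/
lemma edge_mse_eq_iff {s E : ℝ} (hs : 0 < s) (hE : 0 < E) (p δ : ℝ) :
    s * p + (1 - p) * (s - E⁻¹ / s) = δ ↔ p = 1 + (δ - s) * s * E := by
  constructor
  · rintro rfl
    field_simp
    ring
  · rintro rfl
    field_simp
    ring

/-- A positive base `a ≠ 1` raised to a scaled exponent attains a positive value exactly once. -/
lemma rpow_div_eq_iff {a c r : ℝ} (ha : 0 < a) (ha1 : a ≠ 1) (hc : 0 < c) (hr : r ≠ 0) (x : ℝ) :
    a ^ (x / r) = c ↔ x = r * Real.log c / Real.log a := by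
  have hlog : Real.log a ≠ 0 := Real.log_ne_zero_of_pos_of_ne_one ha ha1
  rw [Real.rpow_def_of_pos ha, ← Real.exp_log hc, Real.exp_eq_exp, Real.log_exp,
    eq_div_iff hlog, mul_div_assoc', div_eq_iff hr, mul_comm x, mul_comm r]

/-- Solving the edge-MSE equation for the number of transmission attempts (equation (31)):
with `p(J) = (1−q)^(J/ρ)`, the equation
`σ²·p(J) + (1 − p(J))·(σ² − e^{−2R/b}/σ²) = δ` has the unique real solution
`J = ρ·ln(1 + (δ−σ²)σ²e^{2R/b}) / ln(1−q)`, and this `J` is positive. -/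
theorem optimal_attempts_unique_solution
    (σ b ρ q δ R : ℝ) (hσ : 0 < σ) (hb : 0 < b) (hρ : 0 < ρ)
    (hq0 : 0 < q) (hq1 : q < 1) (hδ0 : 0 ≤ δ) (hδ : δ < σ ^ 2) (hR : 0 < R)
    (hfeas : (σ ^ 2 - δ) * σ ^ 2 * Real.exp (2 * R / b) < 1) :
    (∀ J : ℝ,
      σ ^ 2 * (1 - q) ^ (J / ρ) +
          (1 - (1 - q) ^ (J / ρ)) * (σ ^ 2 - Real.exp (-(2 * R / b)) / σ ^ 2) = δ ↔
        J = ρ * Real.log (1 + (δ - σ ^ 2) * σ ^ 2 * Real.exp (2 * R / b)) /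
              Real.log (1 - q)) ∧
    0 < ρ * Real.log (1 + (δ - σ ^ 2) * σ ^ 2 * Real.exp (2 * R / b)) /
          Real.log (1 - q) := by
  have hE := Real.exp_pos (2 * R / b)
  have hs : 0 < σ ^ 2 := by positivity
  have ha : 0 < 1 - q := by linarith
  have hc : 0 < 1 + (δ - σ ^ 2) * σ ^ 2 * Real.exp (2 * R / b) := by linarith
  have hgap : 0 < (σ ^ 2 - δ) * σ ^ 2 * Real.exp (2 * R / b) :=
    mul_pos (mul_pos (by linarith) hs) hE
  refine ⟨fun J => ?_, div_pos_of_neg_of_neg ?_ (Real.log_neg ha (by linarith))⟩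
  · rw [Real.exp_neg, edge_mse_eq_iff hs hE, rpow_div_eq_iff ha (by simpa using hq0.ne') hc hρ.ne']
  · exact mul_neg_of_pos_of_neg hρ (Real.log_neg hc (by linarith))
end

section
/- Let R > 0 and R_mse > 0, and define θ(w) for w ∈ (0, R] by: θ(w) = 2π if 0 < w ≤ R_mse − R; θ(w) = 2·arccos((R² + w² − R_mse²)/(2 R w)) if |R − R_mse| ≤ w ≤ R_mse + R; and θ(w) = 0 otherwise. Then for every measurable f : ℝ → [0, ∞), the integral of f(‖x‖) over the intersection region A_int = {x ∈ ℝ² : ‖x‖ ≤ R and ‖x − (R, 0)‖ ≤ R_mse} satisfies ∫_{A_int} f(‖x‖) dx = ∫_0^R w · f(w) · θ(w) dw. -/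
open Real MeasureTheory

theorem volume_setOf_le_cos_inter_Ioo (u : ℝ) :
    volume ({φ : ℝ | u ≤ Real.cos φ} ∩ Set.Ioo (-π) π) = ENNReal.ofReal (2 * Real.arccos u) := by
  rcases lt_or_ge 1 u with hu | hu
  · have hempty : {φ : ℝ | u ≤ Real.cos φ} = ∅ := by
      ext φ
      simpa using (Real.cos_le_one φ).trans_lt hu
    simp [hempty, Real.arccos_of_one_le hu.le]
  rcases le_or_gt u (-1) with hu' | hu'
  · have huniv : {φ : ℝ | u ≤ Real.cos φ} = Set.univ := by
      ext φ
      simpa using hu'.trans (Real.neg_one_le_cos φ)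
    rw [huniv, Set.univ_inter, Real.volume_Ioo, Real.arccos_of_le_neg_one hu']
    ring_nf
  · have hlt : Real.arccos u < π :=
      lt_of_le_of_ne (Real.arccos_le_pi u) fun h => hu'.not_ge (Real.arccos_eq_pi.mp h)
    have hset : {φ : ℝ | u ≤ Real.cos φ} ∩ Set.Ioo (-π) π
        = Set.Icc (-Real.arccos u) (Real.arccos u) := by
      ext φ
      simp only [Set.mem_inter_iff, Set.mem_ofPred_eq, ← abs_lt, Set.mem_Ioo, Set.mem_Icc, ← abs_le]
      have key : |φ| ≤ π → (u ≤ Real.cos φ ↔ |φ| ≤ Real.arccos u) := fun h => by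
        rw [← Real.cos_abs φ]
        nth_rewrite 1 [← Real.cos_arccos hu'.le hu]
        exact Real.strictAntiOn_cos.le_iff_ge
          ⟨Real.arccos_nonneg u, hlt.le⟩ ⟨abs_nonneg φ, h⟩
      exact ⟨fun h => (key h.2.le).mp h.1,
        fun h => ⟨(key (h.trans hlt.le)).mpr h, h.trans_lt hlt⟩⟩
    rw [hset, Real.volume_Icc]
    ring_nf

theorem EuclideanSpace.lintegral_eq_polar (g : EuclideanSpace ℝ (Fin 2) → ENNReal)
    (hg : Measurable g) :
    ∫⁻ x, g x = ∫⁻ r in Set.Ioi (0 : ℝ), ∫⁻ φ in Set.Ioo (-π) π,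
      ENNReal.ofReal r * g !₂[r * Real.cos φ, r * Real.sin φ] := by
  have hmk : Measurable fun p : ℝ × ℝ => g !₂[p.1, p.2] := hg.comp (by fun_prop)
  have hpres : ∫⁻ x, g x = ∫⁻ p : ℝ × ℝ, g !₂[p.1, p.2] := by
    rw [← (PiLp.volume_preserving_toLp (Fin 2)).lintegral_comp hg,
      ← (volume_preserving_finTwoArrow ℝ).symm.lintegral_comp
        (f := fun y => g (WithLp.toLp 2 y)) (hg.comp (WithLp.measurable_toLp 2 (Fin 2 → ℝ)))]
    rfl
  rw [hpres, ← lintegral_comp_polarCoord_symm, polarCoord_target, Measure.volume_eq_prod,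
    ← Measure.prod_restrict, lintegral_prod]
  · rfl
  · exact (Measurable.mul (by fun_prop)
      (hmk.comp continuous_polarCoord_symm.measurable)).aemeasurable

theorem lens_angle_eq (R Rmse w : ℝ) (hR : 0 < R) (hRmse : 0 < Rmse) (hw : w ∈ Set.Ioc 0 R) :
    (if w ≤ Rmse - R then 2 * π
      else if |R - Rmse| ≤ w ∧ w ≤ Rmse + R then
        2 * Real.arccos ((R ^ 2 + w ^ 2 - Rmse ^ 2) / (2 * R * w))
      else 0) = 2 * Real.arccos ((R ^ 2 + w ^ 2 - Rmse ^ 2) / (2 * R * w)) := by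
  obtain ⟨hw0, hwR⟩ := hw
  have hpos : 0 < 2 * R * w := by positivity
  split_ifs with h₁ h₂
  · rw [Real.arccos_of_le_neg_one]
    rw [div_le_iff₀ hpos]
    nlinarith
  · rfl
  · have h : w < |R - Rmse| := by
      by_contra! h
      exact h₂ ⟨h, by linarith⟩
    have h' : w < R - Rmse := by
      rcases lt_abs.mp h with h | h <;> linarith
    rw [Real.arccos_of_one_le, mul_zero]
    rw [le_div_iff₀ hpos]
    nlinarith

/-- Polar integration over the lens `A_int = b(0,R) ∩ b((R,0), R_mse)` (equation (33)):
with `θ(w)` the angular measure of the arc at radius `w` inside `b((R,0), R_mse)`,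
`∫_{A_int} f(‖x‖) dx = ∫_0^R w f(w) θ(w) dw` for every measurable nonnegative `f`. -/
theorem lens_polar_integration (R Rmse : ℝ) (hR : 0 < R) (hRmse : 0 < Rmse)
    (θ : ℝ → ℝ)
    (hθ : ∀ w ∈ Set.Ioc (0 : ℝ) R, θ w =
      if w ≤ Rmse - R then 2 * π
      else if |R - Rmse| ≤ w ∧ w ≤ Rmse + R then
        2 * Real.arccos ((R ^ 2 + w ^ 2 - Rmse ^ 2) / (2 * R * w))
      else 0)
    (f : ℝ → ℝ) (hf : Measurable f) (hf0 : ∀ r, 0 ≤ f r) :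
    ∫⁻ x in {x : EuclideanSpace ℝ (Fin 2) |
        ‖x‖ ≤ R ∧ ‖x - ((WithLp.equiv 2 (Fin 2 → ℝ)).symm ![R, 0])‖ ≤ Rmse},
      ENNReal.ofReal (f ‖x‖)
    = ∫⁻ w in Set.Ioc (0 : ℝ) R, ENNReal.ofReal (w * f w * θ w) := by
  set A : Set (EuclideanSpace ℝ (Fin 2)) := {x |
    ‖x‖ ≤ R ∧ ‖x - ((WithLp.equiv 2 (Fin 2 → ℝ)).symm ![R, 0])‖ ≤ Rmse} with hA
  have hAm : MeasurableSet A :=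
    have hballs : A = Metric.closedBall 0 R ∩
        Metric.closedBall ((WithLp.equiv 2 (Fin 2 → ℝ)).symm ![R, 0]) Rmse := by
      ext x
      simp [hA, dist_eq_norm]
    hballs ▸ measurableSet_closedBall.inter measurableSet_closedBall
  have hnorm : ∀ r φ : ℝ, 0 < r → ‖!₂[r * Real.cos φ, r * Real.sin φ]‖ = r := fun r φ hr => by
    rw [EuclideanSpace.norm_eq, Real.sqrt_eq_iff_mul_self_eq_of_pos hr]
    simp only [Fin.sum_univ_two, Real.norm_eq_abs, sq_abs]
    simp only [Matrix.cons_val_zero, Matrix.cons_val_one]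
    linear_combination (-r ^ 2) * Real.sin_sq_add_cos_sq φ
  have hmem : ∀ r φ : ℝ, 0 < r → (!₂[r * Real.cos φ, r * Real.sin φ] ∈ A ↔
      r ≤ R ∧ (R ^ 2 + r ^ 2 - Rmse ^ 2) / (2 * R * r) ≤ Real.cos φ) := fun r φ hr => by
    rw [hA, Set.mem_ofPred_eq, hnorm r φ hr, EuclideanSpace.norm_eq, Real.sqrt_le_left hRmse.le,
      div_le_iff₀ (by positivity)]
    simp only [Fin.sum_univ_two, Real.norm_eq_abs, sq_abs]
    refine and_congr_right fun _ => ?_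
    have := Real.sin_sq_add_cos_sq φ
    have hexp : (r * Real.cos φ - R) ^ 2 + (r * Real.sin φ - 0) ^ 2
        = r ^ 2 + R ^ 2 - Real.cos φ * (2 * R * r) := by
      linear_combination r ^ 2 * this
    change (r * Real.cos φ - R) ^ 2 + (r * Real.sin φ - 0) ^ 2 ≤ Rmse ^ 2 ↔ _
    rw [hexp]
    constructor <;> intro h <;> linarith
  rw [← lintegral_indicator hAm, EuclideanSpace.lintegral_eq_polar _
    (Measurable.indicator (by fun_prop) hAm),
    ← Set.Ioi_inter_Iic, Set.inter_comm, ← setLIntegral_indicator measurableSet_Iic]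
  refine setLIntegral_congr_fun measurableSet_Ioi fun r hr => ?_
  have hr : 0 < r := hr
  by_cases hrR : r ≤ R
  · set S : Set ℝ := {φ | (R ^ 2 + r ^ 2 - Rmse ^ 2) / (2 * R * r) ≤ Real.cos φ} with hS
    have hSm : MeasurableSet S := measurableSet_le (by fun_prop) (by fun_prop)
    have hint : ∀ φ : ℝ, ENNReal.ofReal r * A.indicator (fun x => ENNReal.ofReal (f ‖x‖))
        !₂[r * Real.cos φ, r * Real.sin φ]
        = S.indicator (fun _ => ENNReal.ofReal (r * f r)) φ := fun φ => by
      by_cases hφ : φ ∈ S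
      · rw [Set.indicator_of_mem hφ, Set.indicator_of_mem ((hmem r φ hr).mpr ⟨hrR, hφ⟩),
          hnorm r φ hr, ENNReal.ofReal_mul hr.le]
      · rw [Set.indicator_of_notMem hφ,
          Set.indicator_of_notMem fun h => hφ ((hmem r φ hr).mp h).2, mul_zero]
    simp only [hint]
    rw [lintegral_indicator hSm, setLIntegral_const, Measure.restrict_apply hSm,
      volume_setOf_le_cos_inter_Ioo, Set.indicator_of_mem (show r ∈ Set.Iic R from hrR),
      hθ r ⟨hr, hrR⟩, lens_angle_eq R Rmse r hR hRmse ⟨hr, hrR⟩,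
      ENNReal.ofReal_mul (mul_nonneg hr.le (hf0 r))]
  · have hint : ∀ φ : ℝ, ENNReal.ofReal r * A.indicator (fun x => ENNReal.ofReal (f ‖x‖))
        !₂[r * Real.cos φ, r * Real.sin φ] = 0 := fun φ => by
      rw [Set.indicator_of_notMem fun h => hrR ((hmem r φ hr).mp h).1, mul_zero]
    simp only [hint, lintegral_zero]
    rw [Set.indicator_of_notMem (show r ∉ Set.Iic R from hrR)]
end
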